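/- arXiv:2206.10115 — 2 statements merged into one kernel-verified Lean document; each statement's English description precedes it below -/
import Mathlib

section
/- Let S be a left and right noetherian prime ring and let a ∈ S be a cancellative nonunit. Then no cancellative element of S lies in ⋂_{k ≥ 0} a^k S, i.e., S^• ∩ ⋂_{k ≥ 0} a^k S = ∅. -/
/-- An element `c` of a monoid is *cancellative* if it can be cancelled on both sides. -/
def IsCancellative {R : Type*} [Monoid R] (c : R) : Prop :=
  (∀ x y : R, c * x = c * y → x = y) ∧ (∀ x y : R, x * c = y * c → x = y)

/-- A ring is *prime* if `a r b = 0` for all `r` implies `a = 0` or `b = 0`. -/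
def IsPrimeRing (R : Type*) [Ring R] : Prop :=
  ∀ a b : R, (∀ r : R, a * r * b = 0) → a = 0 ∨ b = 0

/-- The chain of left ideals `S x + S x d + ⋯ + S x d ^ (n - 1)`. -/
def auxChain {S : Type*} [Ring S] (x d : S) : ℕ → Submodule S S
  | 0 => ⊥
  | n + 1 => Submodule.span S {x} ⊔ (auxChain x d n).map (LinearMap.toSpanSingleton S S d)

theorem auxChain_mono {S : Type*} [Ring S] (x d : S) : Monotone (auxChain x d) := by
  apply monotone_nat_of_le_succ
  intro n
  induction n with
  | zero => exact bot_le
  | succ n ih => exact sup_le_sup le_rfl (Submodule.map_mono ih)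

theorem auxChain_mem {S : Type*} [Ring S] (x d : S) (n : ℕ) :
    x * d ^ n ∈ auxChain x d (n + 1) := by
  induction n with
  | zero =>
    simp only [pow_zero, mul_one]
    exact Submodule.mem_sup_left (Submodule.mem_span_singleton_self x)
  | succ n ih =>
    refine Submodule.mem_sup_right ⟨x * d ^ n, ih, ?_⟩
    simp [pow_succ, mul_assoc]

theorem aux_essential {S : Type*} [Ring S] (hnl : IsNoetherian S S) (x d : S)
    (hd : ∀ x y : S, x * d = y * d → x = y)
    (h : ∀ t v : S, t * x = v * d → t * x = 0) : x = 0 := by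
  have key : ∀ n, x * d ^ n ∈ auxChain x d n → x = 0 := by
    intro n
    induction n with
    | zero =>
      intro hx
      simpa [auxChain] using hx
    | succ n ih =>
      intro hx
      obtain ⟨p, hp, q, hq, hpq⟩ := Submodule.mem_sup.1 hx
      obtain ⟨s, rfl⟩ := Submodule.mem_span_singleton.1 hp
      obtain ⟨y, hy, rfl⟩ := hq
      simp only [smul_eq_mul, LinearMap.toSpanSingleton_apply] at hpq
      have h0 : s * x = 0 := by
        apply h s (x * d ^ n - y)
        rw [sub_mul, mul_assoc, ← pow_succ, ← hpq]
        simp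
      rw [h0, zero_add, pow_succ, ← mul_assoc] at hpq
      have := hd _ _ hpq
      exact ih (this ▸ hy)
  obtain ⟨n, hn⟩ := monotone_stabilizes_iff_noetherian.2 hnl ⟨auxChain x d, auxChain_mono x d⟩
  apply key n
  have h1 : auxChain x d n = auxChain x d (n + 1) := hn (n + 1) (Nat.le_succ n)
  rw [h1]
  exact auxChain_mem x d n

theorem aux_pow_cancel {S : Type*} [Ring S] (a : S) (ha : IsCancellative a) (k : ℕ) :
    IsCancellative (a ^ k) := by
  induction k with
  | zero => exact ⟨fun x y h => by simpa using h, fun x y h => by simpa using h⟩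
  | succ k ih =>
    constructor
    · intro x y h
      rw [pow_succ, mul_assoc, mul_assoc] at h
      exact ha.1 _ _ (ih.1 _ _ h)
    · intro x y h
      rw [pow_succ, ← mul_assoc, ← mul_assoc] at h
      exact ih.2 _ _ (ha.2 _ _ h)

/-- Let `S` be a left and right noetherian prime ring and let
`a ∈ S` be a cancellative nonunit.  Then no cancellative element of `S` lies in
`⋂_{k ≥ 0} aᵏS`. -/
theorem cancellative_not_mem_iInter_pow_mul {S : Type*} [Ring S]
    (hprime : IsPrimeRing S) (hnl : IsNoetherian S S) (hnr : IsNoetherian Sᵐᵒᵖ S)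
    (a : S) (ha : IsCancellative a) (hna : ¬ IsUnit a) :
    ∀ b : S, IsCancellative b → b ∉ ⋂ k : ℕ, {x : S | ∃ c : S, x = a ^ k * c} := by
  intro b hb hmem
  rw [Set.mem_iInter] at hmem
  choose c hc using hmem
  have hstep : ∀ k, c k = a * c (k + 1) := by
    intro k
    apply (aux_pow_cancel a ha k).1
    rw [← mul_assoc, ← pow_succ, ← hc, ← hc]
  have hmono : Monotone fun k => Submodule.span S {c k} := by
    apply monotone_nat_of_le_succ
    intro k
    rw [Submodule.span_singleton_le_iff_mem, Submodule.mem_span_singleton]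
    exact ⟨a, (hstep k).symm⟩
  obtain ⟨n, hn⟩ := monotone_stabilizes_iff_noetherian.2 hnl
    ⟨fun k => Submodule.span S {c k}, hmono⟩
  have h1 : Submodule.span S {c n} = Submodule.span S {c (n + 1)} := hn (n + 1) (Nat.le_succ n)
  have h2 : c (n + 1) ∈ Submodule.span S {c n} := by
    rw [h1]
    exact Submodule.mem_span_singleton_self _
  obtain ⟨s, hs⟩ := Submodule.mem_span_singleton.1 h2
  rw [smul_eq_mul, hstep n, ← mul_assoc] at hs
  have h3 : s * a - 1 = 0 := by
    apply aux_essential hnl _ (a ^ (n + 1)) (aux_pow_cancel a ha (n + 1)).2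
    intro t v htv
    have hv : v * b = 0 * b := by
      rw [hc (n + 1), ← mul_assoc, ← htv, mul_assoc, sub_mul, hs]
      simp
    rw [htv, hb.2 _ _ hv, zero_mul]
  have h4 : s * a = 1 := sub_eq_zero.1 h3
  have h5 : a * s = 1 := by
    apply ha.2
    rw [mul_assoc, h4, mul_one, one_mul]
  exact hna ⟨⟨a, s, h5, h4⟩, rfl⟩
end

section
/- Let K be a field and let R be an affine (finitely generated as a K-algebra) left and right noetherian prime K-algebra of quadratic growth. Then R is a BF-ring. -/
/-- The submonoid of cancellative elements of a monoid. -/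
def cancellativeSubmonoid (R : Type*) [Monoid R] : Submonoid R where
  carrier := {c | IsCancellative c}
  one_mem' := ⟨fun x y h => by simpa using h, fun x y h => by simpa using h⟩
  mul_mem' := by
    rintro a b ⟨hal, har⟩ ⟨hbl, hbr⟩
    constructor
    · intro x y h
      exact hbl x y (hal (b * x) (b * y) (by rw [← mul_assoc, ← mul_assoc]; exact h))
    · intro x y h
      exact har x y (hbr (x * a) (y * a) (by rw [mul_assoc, mul_assoc]; exact h))

/-- The set of lengths of factorizations of `a` into atoms (irreducible elements). -/
def mulLengthSet {H : Type*} [Monoid H] (a : H) : Set ℕ :=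
  {k | ∃ l : List H, (∀ x ∈ l, Irreducible x) ∧ l.prod = a ∧ l.length = k}

/-- A monoid is *atomic* if every nonunit is a finite product of atoms. -/
def IsAtomicMonoid (H : Type*) [Monoid H] : Prop :=
  ∀ a : H, ¬ IsUnit a → ∃ l : List H, (∀ x ∈ l, Irreducible x) ∧ l.prod = a

/-- A monoid is a *BF-monoid* if it is atomic and all length sets are finite. -/
def IsBFMonoid (H : Type*) [Monoid H] : Prop :=
  IsAtomicMonoid H ∧ ∀ a : H, (mulLengthSet a).Finite

/-- A ring is a *BF-ring* if its monoid of cancellative elements is a BF-monoid. -/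
def IsBFRing (R : Type*) [Ring R] : Prop :=
  IsBFMonoid (cancellativeSubmonoid R)

namespace BFQ
open Polynomial

lemma finrank_map_inj {K M N : Type*} [Field K] [AddCommGroup M] [Module K M] [AddCommGroup N]
    [Module K N] (f : M →ₗ[K] N) (hf : Function.Injective f) (p : Submodule K M) :
    Module.finrank K (p.map f) = Module.finrank K p :=
  (Submodule.equivMapOfInjective f hf p).finrank_eq.symm

/-- Matrices whose entries are polynomials of degree less than `e`. -/
noncomputable def polyMat (K F ι : Type*) [Field K] [Field F] [Algebra K[X] F] [Algebra K F]
    [IsScalarTower K K[X] F] (e : ℕ) : Submodule K (Matrix ι ι F) :=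
  LinearMap.range
    ({ toFun := fun f => Matrix.of fun i j => algebraMap K[X] F (f i j).1
       map_add' := by intros; ext; simp
       map_smul' := by
        intros; ext
        simp [Algebra.smul_def, IsScalarTower.algebraMap_apply K K[X] F] } :
      (ι → ι → Polynomial.degreeLT K e) →ₗ[K] Matrix ι ι F)

variable {K F ι : Type*} [Field K] [Field F] [Algebra K[X] F] [Algebra K F]
    [IsScalarTower K K[X] F]

lemma mem_polyMat {e : ℕ} {M : Matrix ι ι F} :
    M ∈ polyMat K F ι e ↔ ∀ i j, ∃ p ∈ Polynomial.degreeLT K e, algebraMap K[X] F p = M i j := by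
  constructor
  · rintro ⟨f, rfl⟩ i j
    exact ⟨f i j, (f i j).2, rfl⟩
  · intro h
    choose f hf hf' using h
    exact ⟨fun i j => ⟨f i j, hf i j⟩, by ext i j; exact hf' i j⟩

lemma finrank_polyMat [Fintype ι] (e : ℕ) :
    Module.Finite K (polyMat K F ι e) ∧
    Module.finrank K (polyMat K F ι e) ≤ Fintype.card ι * Fintype.card ι * e := by
  have : Module.Finite K (Polynomial.degreeLT K e) :=
    Module.Finite.equiv (Polynomial.degreeLTEquiv K e).symm
  refine ⟨by unfold polyMat; infer_instance, ?_⟩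
  refine (LinearMap.finrank_range_le _).trans ?_
  rw [Module.finrank_pi_fintype]
  simp [Module.finrank_pi_fintype, (Polynomial.degreeLTEquiv K e).finrank_eq, mul_assoc]

lemma polyMat_mono {d e : ℕ} (h : d ≤ e) : polyMat K F ι d ≤ polyMat K F ι e := by
  intro M hM
  rw [mem_polyMat] at *
  intro i j
  obtain ⟨p, hp, hp'⟩ := hM i j
  exact ⟨p, Polynomial.degreeLT_mono h hp, hp'⟩

lemma polyMat_mul [Fintype ι] {d e : ℕ} {M N : Matrix ι ι F}
    (hM : M ∈ polyMat K F ι d) (hN : N ∈ polyMat K F ι e) : M * N ∈ polyMat K F ι (d + e) := by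
  rw [mem_polyMat] at *
  choose f hf hf' using hM
  choose g hg hg' using hN
  intro i j
  refine ⟨∑ k, f i k * g k j, Submodule.sum_mem _ fun k _ => ?_, by simp [Matrix.mul_apply, hf', hg']⟩
  have h1 := hf i k
  have h2 := hg k j
  rw [Polynomial.mem_degreeLT] at *
  by_cases h0 : f i k * g k j = 0
  · rw [h0]; simp
  · have hf0 : f i k ≠ 0 := left_ne_zero_of_mul h0
    have hg0 : g k j ≠ 0 := right_ne_zero_of_mul h0
    rw [Polynomial.degree_mul, Polynomial.degree_eq_natDegree hf0, Polynomial.degree_eq_natDegree hg0] at *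
    norm_cast at *
    omega

lemma growth_matrix [IsFractionRing K[X] F] [Fintype ι] [DecidableEq ι]
    (V : Submodule K (Matrix ι ι F))
    (hV : V.FG) : ∃ C : ℕ, ∀ n : ℕ, Module.finrank K ↥(V ^ n) ≤ C * (n + 1) := by
  classical
  obtain ⟨S, rfl⟩ := hV
  let T : Finset F := S.biUnion fun M => Finset.univ.biUnion fun i => Finset.univ.image fun j => M i j
  obtain ⟨g, hg⟩ := IsLocalization.exist_integer_multiples_of_finset (nonZeroDivisors K[X]) T
  choose! p hp using hg
  let e := T.sup (fun a => (p a).natDegree) + 1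
  have hg0 : algebraMap K[X] F g ≠ 0 := by
    simp
  have hS : ∀ x ∈ Submodule.span K (S : Set (Matrix ι ι F)),
      algebraMap K[X] F g • x ∈ polyMat K F ι e := by
    intro x hx
    induction hx using Submodule.span_induction with
    | mem x hx =>
      rw [mem_polyMat]
      intro i j
      have hT : x i j ∈ T := by
        simp only [T, Finset.mem_biUnion, Finset.mem_image, Finset.mem_univ, true_and]
        exact ⟨x, hx, i, j, rfl⟩
      refine ⟨p (x i j), ?_, ?_⟩
      · rw [Polynomial.mem_degreeLT]
        refine lt_of_le_of_lt Polynomial.degree_le_natDegree ?_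
        have : (p (x i j)).natDegree ≤ T.sup (fun a => (p a).natDegree) :=
          Finset.le_sup (f := fun a => (p a).natDegree) hT
        norm_cast
        omega
      · rw [hp _ hT, Matrix.smul_apply, Algebra.smul_def, smul_eq_mul]
    | zero => simp
    | add x y _ _ hx hy => rw [smul_add]; exact add_mem hx hy
    | smul a x _ hx => rw [smul_comm]; exact Submodule.smul_mem _ _ hx
  have hn : ∀ n : ℕ, ∀ x ∈ (Submodule.span K (S : Set (Matrix ι ι F))) ^ n,
      algebraMap K[X] F g ^ n • x ∈ polyMat K F ι (n * e + 1) := by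
    intro n
    induction n with
    | zero =>
      intro x hx
      rw [pow_zero, Submodule.mem_one] at hx
      obtain ⟨a, rfl⟩ := hx
      rw [mem_polyMat]
      intro i j
      refine ⟨if i = j then Polynomial.C a else 0, ?_, ?_⟩
      · rw [Polynomial.mem_degreeLT]
        split_ifs
        · exact lt_of_le_of_lt Polynomial.degree_C_le (by simp)
        · simp
      · rw [pow_zero, one_smul, Matrix.algebraMap_matrix_apply, apply_ite (algebraMap K[X] F), map_zero,
          IsScalarTower.algebraMap_apply K K[X] F]
        rfl
    | succ n ih =>
      intro x hx
      rw [pow_succ] at hx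
      induction hx using Submodule.mul_induction_on' with
      | mem_mul_mem a ha b hb =>
        have := polyMat_mul (ih a ha) (hS b hb)
        rw [smul_mul_smul_comm, ← pow_succ] at this
        convert this using 2
        ring
      | add x _ y _ hx hy => rw [smul_add]; exact add_mem hx hy
  refine ⟨Fintype.card ι * Fintype.card ι * (e + 1), fun n => ?_⟩
  obtain ⟨hfin, hle⟩ := finrank_polyMat (K := K) (F := F) (ι := ι) (n * e + 1)
  let μ : Matrix ι ι F →ₗ[K] Matrix ι ι F :=
    { toFun := fun x => algebraMap K[X] F g ^ n • x
      map_add' := smul_add _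
      map_smul' := fun a x => smul_comm _ _ _ }
  have hμ : Function.Injective μ := fun x y h => smul_right_injective _ (pow_ne_zero n hg0) h
  have h1 : Submodule.map μ ((Submodule.span K (S : Set (Matrix ι ι F))) ^ n) ≤ polyMat K F ι (n * e + 1) := by
    rintro _ ⟨x, hx, rfl⟩
    exact hn n x hx
  have h2 := Submodule.finrank_mono h1
  rw [finrank_map_inj μ hμ] at h2
  refine h2.trans (hle.trans ?_)
  rw [mul_assoc _ (e + 1)]
  exact Nat.mul_le_mul_left _ (by nlinarith)

lemma growth_alg [IsFractionRing K[X] F] {A : Type*} [Ring A] [Algebra F A] [Algebra K A]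
    [IsScalarTower K F A] [Module.Finite F A] (V : Submodule K A)
    (hV : V.FG) : ∃ C : ℕ, ∀ n : ℕ, Module.finrank K ↥(V ^ n) ≤ C * (n + 1) := by
  classical
  let b := Module.finBasis F A
  let f : A →ₐ[K] Matrix _ _ F := (Algebra.leftMulMatrix b).restrictScalars K
  have hf : Function.Injective f := Algebra.leftMulMatrix_injective b
  obtain ⟨C, hC⟩ := growth_matrix (K := K) (V.map f.toLinearMap) (hV.map _)
  refine ⟨C, fun n => ?_⟩
  rw [← finrank_map_inj f.toLinearMap hf, Submodule.map_pow]
  exact hC n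


lemma nak {O M : Type*} [CommRing O] [AddCommGroup M] [Module O M] (G : Set M) (hG : G.Finite)
    (t : O) (h : ∀ g ∈ G, ∃ n ∈ Submodule.span O G, g = t • n) :
    ∃ r o : O, r - 1 = t * o ∧ ∀ y ∈ Submodule.span O G, r • y = 0 := by
  obtain ⟨r, hr, hrN⟩ := Submodule.exists_sub_one_mem_and_smul_eq_zero_of_fg_of_le_smul
    (Ideal.span {t}) (Submodule.span O G) (Submodule.fg_span hG) (by
      refine Submodule.span_le.2 fun g hg => ?_
      obtain ⟨n, hn, rfl⟩ := h g hg
      exact Submodule.smul_mem_smul (Ideal.mem_span_singleton_self t) hn)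
  obtain ⟨o, ho⟩ := Ideal.mem_span_singleton.1 hr
  exact ⟨r, o, ho, hrN⟩

lemma nak2 {L M : Type*} [Field L] (O : Subring L) [AddCommGroup M] [Module L M] (G : Set M)
    (hG : G.Finite) (t : O) (h : ∀ g ∈ G, ∃ n ∈ Submodule.span O G, g = t • n)
    (ht : ∀ o : O, (1 : L) + (t : L) * (o : L) ≠ 0) : ∀ y ∈ Submodule.span O G, y = 0 := by
  obtain ⟨r, o, ho, hrN⟩ := nak G hG t h
  have hr : (r : L) = 1 + (t : L) * (o : L) := by
    have := congrArg (Subtype.val) ho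
    push_cast at this
    rw [← this]; ring
  intro y hy
  have h1 : (r : L) • y = 0 := hrN y hy
  exact (smul_eq_zero.1 h1).resolve_left (by rw [hr]; exact ht o)

set_option maxHeartbeats 1000000 in
open scoped PowerSeries in
lemma field_finite {K E F R : Type*} [Field K] [Field F] [Field E] [Algebra K[X] F] [Algebra K F]
    [IsScalarTower K K[X] F] [Algebra F E] [Algebra K E] [IsScalarTower K F E]
    [Algebra K⟦X⟧ E] [IsScalarTower K K⟦X⟧ E]
    (hinj : Function.Injective (algebraMap K⟦X⟧ E))
    (hX : algebraMap F E (algebraMap K[X] F Polynomial.X) = algebraMap K⟦X⟧ E PowerSeries.X)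
    [Ring R] [Algebra K R] (S : Finset R) (hS : Algebra.adjoin K (S : Set R) = ⊤)
    {m : ℕ} (φ : R →ₗ[K] (Fin m → K⟦X⟧)) (ρ : R →ₐ[K] Matrix (Fin m) (Fin m) K⟦X⟧)
    (hφρ : ∀ r, φ r = Matrix.vecMul (φ 1) (ρ r))
    (h1 : ∀ r, ∃ s, ∀ j, ∃ c : K, φ r j = PowerSeries.C c + PowerSeries.X * φ s j)
    (h2 : ∀ r i, ∃ x, ∀ j, ρ r i j = φ x j) :
    ∃ L : IntermediateField F E, Module.Finite F L ∧
      ∀ r i j, algebraMap K⟦X⟧ E (ρ r i j) ∈ L := by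
  classical
  let ι := algebraMap K⟦X⟧ E
  let T : Set E := (Set.range fun j => ι (φ 1 j)) ∪
    (Set.range fun x : S × Fin m × Fin m => ι (ρ x.1 x.2.1 x.2.2))
  have hTfin : T.Finite := (Set.finite_range _).union (Set.finite_range _)
  let L := IntermediateField.adjoin F T
  have hTL : T ⊆ L := IntermediateField.subset_adjoin F T
  have hι : ∀ c : K, ι (algebraMap K K⟦X⟧ c) = algebraMap F E (algebraMap K F c) := by
    intro c
    rw [← IsScalarTower.algebraMap_apply, ← IsScalarTower.algebraMap_apply]
  have hρL : ∀ r i j, ι (ρ r i j) ∈ L := by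
    intro r
    have hr : r ∈ Algebra.adjoin K (S : Set R) := by rw [hS]; trivial
    induction hr using Algebra.adjoin_induction with
    | mem x hx => exact fun i j => hTL (Or.inr ⟨⟨⟨x, hx⟩, i, j⟩, rfl⟩)
    | algebraMap c =>
      intro i j
      rw [AlgHom.commutes, Matrix.algebraMap_matrix_apply]
      split_ifs
      · rw [hι]; exact L.algebraMap_mem _
      · simp
    | add x y _ _ hx hy =>
      intro i j
      rw [map_add, Matrix.add_apply, map_add]
      exact add_mem (hx i j) (hy i j)
    | mul x y _ _ hx hy =>
      intro i j
      rw [map_mul, Matrix.mul_apply, map_sum]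
      refine sum_mem fun k _ => ?_
      rw [map_mul]
      exact mul_mem (hx i k) (hy k j)
  have hφL : ∀ r j, ι (φ r j) ∈ L := by
    intro r j
    rw [hφρ, Matrix.vecMul, dotProduct, map_sum]
    refine sum_mem fun k _ => ?_
    rw [map_mul]
    exact mul_mem (hTL (Or.inl ⟨k, rfl⟩)) (hρL r k j)
  refine ⟨L, ?_, hρL⟩
  let a : R → Fin m → Fin m → L := fun r i j => ⟨ι (ρ r i j), hρL r i j⟩
  let b : R → Fin m → L := fun r j => ⟨ι (φ r j), hφL r j⟩
  let D := KaehlerDifferential.D F L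
  let O : Subring L := ι.range.comap (algebraMap L E)
  have haO : ∀ r i j, a r i j ∈ O := fun r i j => ⟨ρ r i j, rfl⟩
  have hbO : ∀ r j, b r j ∈ O := fun r j => ⟨φ r j, rfl⟩
  let G : Set (Ω[L⁄F]) := (Set.range fun j => D (b 1 j)) ∪
    (Set.range fun x : S × Fin m × Fin m => D (a x.1 x.2.1 x.2.2))
  have hGfin : G.Finite := (Set.finite_range _).union (Set.finite_range _)
  let N : Submodule O (Ω[L⁄F]) := Submodule.span O G
  have hO : ∀ (x : L) (_ : x ∈ O) (y : Ω[L⁄F]), y ∈ N → x • y ∈ N :=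
    fun x hx y hy => N.smul_mem ⟨x, hx⟩ hy
  have hDa : ∀ r i j, D (a r i j) ∈ N := by
    intro r
    have hr : r ∈ Algebra.adjoin K (S : Set R) := by rw [hS]; trivial
    induction hr using Algebra.adjoin_induction with
    | mem x hx => exact fun i j => Submodule.subset_span (Or.inr ⟨⟨⟨x, hx⟩, i, j⟩, rfl⟩)
    | algebraMap c =>
      intro i j
      have : a (algebraMap K R c) i j = algebraMap F L (if i = j then algebraMap K F c else 0) := by
        apply Subtype.ext
        change ι (ρ _ i j) = algebraMap F E _
        rw [AlgHom.commutes, Matrix.algebraMap_matrix_apply]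
        split_ifs
        · exact hι c
        · simp
      rw [this, Derivation.map_algebraMap]
      exact zero_mem _
    | add x y _ _ hx hy =>
      intro i j
      have : a (x + y) i j = a x i j + a y i j := by
        apply Subtype.ext
        change ι (ρ _ i j) = ι (ρ _ i j) + ι (ρ _ i j)
        simp
      rw [this, map_add]
      exact add_mem (hx i j) (hy i j)
    | mul x y _ _ hx hy =>
      intro i j
      have : a (x * y) i j = ∑ k, a x i k * a y k j := by
        apply Subtype.ext
        rw [AddSubmonoidClass.coe_finsetSum]
        change ι (ρ _ i j) = ∑ k, ι (ρ _ i k) * ι (ρ _ k j)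
        simp [Matrix.mul_apply]
      rw [this, map_sum]
      refine sum_mem fun k _ => ?_
      rw [Derivation.leibniz]
      exact add_mem (hO _ (haO _ _ _) _ (hy k j)) (hO _ (haO _ _ _) _ (hx i k))
  have hDb : ∀ r j, D (b r j) ∈ N := by
    intro r j
    have : b r j = ∑ k, b 1 k * a r k j := by
      apply Subtype.ext
      rw [AddSubmonoidClass.coe_finsetSum]
      change ι (φ r j) = ∑ k, ι (φ _ k) * ι (ρ _ k j)
      rw [hφρ, Matrix.vecMul, dotProduct, map_sum]
      simp
    rw [this, map_sum]
    refine sum_mem fun k _ => ?_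
    rw [Derivation.leibniz]
    exact add_mem (hO _ (hbO _ _) _ (hDa r k j)) (hO _ (haO _ _ _) _ (Submodule.subset_span (Or.inl ⟨k, rfl⟩)))
  let tF : F := algebraMap K[X] F Polynomial.X
  let t : O := ⟨algebraMap F L tF, ⟨PowerSeries.X, hX.symm⟩⟩
  have hDb' : ∀ r j, ∃ n ∈ N, D (b r j) = t • n := by
    intro r j
    obtain ⟨s, hs⟩ := h1 r
    obtain ⟨c, hc⟩ := hs j
    have : b r j = algebraMap F L (algebraMap K F c) + algebraMap F L tF * b s j := by
      apply Subtype.ext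
      change ι (φ r j) = algebraMap F E _ + algebraMap F E tF * ι (φ s j)
      rw [hc, map_add, map_mul, ← hι, hX]
      rfl
    have h3 : D (b r j) = t • D (b s j) := by
      rw [this, map_add, Derivation.map_algebraMap, zero_add, Derivation.leibniz,
        Derivation.map_algebraMap, smul_zero, add_zero]
      rfl
    exact ⟨_, hDb s j, h3⟩
  have hNle : ∀ g ∈ G, ∃ n ∈ N, g = t • n := by
    rintro _ (⟨j, rfl⟩ | ⟨⟨x, i, j⟩, rfl⟩)
    · exact hDb' 1 j
    · obtain ⟨y, hy⟩ := h2 x i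
      have : a x i j = b y j := Subtype.ext (congrArg ι (hy j))
      change ∃ n ∈ N, D (a x i j) = t • n
      rw [this]
      exact hDb' y j
  have hN0 : ∀ y ∈ N, y = 0 := by
    refine nak2 O G hGfin t hNle fun o h0 => ?_
    obtain ⟨f, hf⟩ := o.2
    have h4 := congrArg (algebraMap L E) h0
    rw [map_add, map_mul, map_one, map_zero] at h4
    have h5 : ι (1 + PowerSeries.X * f) = ι 0 := by
      rw [map_add, map_mul, map_zero, map_one, hf, ← hX]
      exact h4
    have h6 := congrArg PowerSeries.constantCoeff (hinj h5)
    simp at h6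
  have hDz : ∀ z : E, ∀ hz : z ∈ L, D ⟨z, hz⟩ = 0 := by
    intro z hz
    induction hz using IntermediateField.adjoin_induction with
    | mem x hx =>
      rcases hx with ⟨j, rfl⟩ | ⟨⟨x, i, j⟩, rfl⟩
      · exact hN0 _ (hDb 1 j)
      · exact hN0 _ (hDa x i j)
    | algebraMap x => exact Derivation.map_algebraMap D x
    | add x y hx hy h h' =>
      have := D.map_add (⟨x, hx⟩ : L) ⟨y, hy⟩
      rw [h, h', add_zero] at this
      exact this
    | inv x hx h =>
      have := D.leibniz_inv (⟨x, hx⟩ : L)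
      rw [h, smul_zero] at this
      exact this
    | mul x y hx hy h h' =>
      have := D.leibniz (⟨x, hx⟩ : L) ⟨y, hy⟩
      rw [h, h', smul_zero, smul_zero, add_zero] at this
      exact this
  have hsub : Subsingleton (Ω[L⁄F]) := by
    rw [← Submodule.subsingleton_iff L, ← subsingleton_iff_bot_eq_top,
      ← KaehlerDifferential.span_range_derivation, eq_comm, Submodule.span_eq_bot]
    rintro _ ⟨z, rfl⟩
    exact hDz z.1 z.2
  have : Algebra.FormallyUnramified F L := ⟨hsub⟩
  have : Algebra.EssFiniteType F L :=
    IntermediateField.essFiniteType_iff.2 ⟨hTfin.toFinset, by simp [L]⟩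
  exact Algebra.FormallyUnramified.finite_of_free F L


lemma growth_matL {K F L : Type*} [Field K] [Field F] [Algebra K F] [Algebra K[X] F] [IsScalarTower K K[X] F]
    [IsFractionRing K[X] F] [Field L] [Algebra F L] [Algebra K L]
    [IsScalarTower K F L] [Module.Finite F L] {m : ℕ} (V : Submodule K (Matrix (Fin m) (Fin m) L))
    (hV : V.FG) : ∃ C : ℕ, ∀ n : ℕ, Module.finrank K ↥(V ^ n) ≤ C * (n + 1) :=
  growth_alg (K := K) (F := F) V hV

open scoped PowerSeries in
lemma exists_rep {K R : Type*} [Field K] [Ring R] [Algebra K R] (u : R)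
    (hu : ∀ x y : R, u * x = u * y → x = y)
    (hfin : Module.Finite K (R ⧸ LinearMap.range (LinearMap.mulLeft K u))) :
    ∃ (m : ℕ) (φ : R →ₗ[K] (Fin m → K⟦X⟧)) (ρ : R →ₐ[K] Matrix (Fin m) (Fin m) K⟦X⟧),
      (∀ r, φ r = Matrix.vecMul (φ 1) (ρ r)) ∧
      (∀ r, ∃ s, ∀ j, ∃ c : K, φ r j = PowerSeries.C c + PowerSeries.X * φ s j) ∧
      (∀ r i, ∃ x, ∀ j, ρ r i j = φ x j) ∧
      (∀ r, φ r = 0 → ∀ k : ℕ, ∃ s, r = u ^ k * s) := by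
  classical
  let U := LinearMap.range (LinearMap.mulLeft K u)
  let m := Module.finrank K (R ⧸ U)
  let e : (R ⧸ U) ≃ₗ[K] (Fin m → K) := (Module.finBasis K (R ⧸ U)).equivFun
  let π : R →ₗ[K] (Fin m → K) := e.toLinearMap ∘ₗ U.mkQ
  have hπs : Function.Surjective π := e.surjective.comp U.mkQ_surjective
  obtain ⟨w, hw⟩ := LinearMap.exists_rightInverse_of_surjective π (LinearMap.range_eq_top.2 hπs)
  have hπw : ∀ c, π (w c) = c := fun c => LinearMap.congr_fun hw c
  have hπ0 : ∀ r, π r = 0 ↔ ∃ s, u * s = r := by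
    intro r
    change e (U.mkQ r) = 0 ↔ _
    rw [LinearEquiv.map_eq_zero_iff, Submodule.mkQ_apply, Submodule.Quotient.mk_eq_zero]
    rfl
  have hex : ∀ r, ∃ s, u * s = r - w (π r) := by
    intro r
    rw [← hπ0, map_sub, hπw, sub_self]
  choose q0 hq0 using hex
  let q : R →ₗ[K] R :=
    { toFun := q0
      map_add' := by
        intro x y
        apply hu
        rw [mul_add, hq0, hq0, hq0, map_add, map_add]; abel
      map_smul' := by
        intro c x
        apply hu
        rw [RingHom.id_apply, mul_smul_comm, hq0, hq0, map_smul, map_smul, smul_sub] }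
  have hq : ∀ r, r = w (π r) + u * q r := by
    intro r
    change r = w (π r) + u * q0 r
    rw [hq0]; abel
  have hπu : ∀ r, π (u * r) = 0 := fun r => (hπ0 _).2 ⟨r, rfl⟩
  have hqu : ∀ r, q (u * r) = r := by
    intro r
    apply hu
    have := hq (u * r)
    rw [hπu, map_zero, zero_add] at this
    exact this.symm
  have hqw : ∀ c, q (w c) = 0 := by
    intro c
    apply hu
    have := hq (w c)
    rw [hπw] at this
    rw [mul_zero]
    exact left_eq_add.1 this
  let φ : R →ₗ[K] (Fin m → K⟦X⟧) :=
    { toFun := fun r j => PowerSeries.mk fun k => π ((q ^ k) r) j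
      map_add' := by intro x y; ext j k; simp
      map_smul' := by intro c x; ext j k; simp }
  have hφc : ∀ r j k, PowerSeries.coeff k (φ r j) = π ((q ^ k) r) j := by
    intro r j k
    exact PowerSeries.coeff_mk (R := K) k (fun k => π ((q ^ k) r) j)
  have hφq : ∀ r j, φ r j = PowerSeries.C (π r j) + PowerSeries.X * φ (q r) j := by
    intro r j
    ext k
    rcases k with _ | k
    · simp [hφc]
    · rw [hφc, map_add, PowerSeries.coeff_succ_X_mul, hφc, pow_succ]
      simp [PowerSeries.coeff_C]
  have hφu : ∀ r j, φ (u * r) j = PowerSeries.X * φ r j := by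
    intro r j
    rw [hφq, hπu, hqu]; simp
  have hφw : ∀ c j, φ (w c) j = PowerSeries.C (c j) := by
    intro c j
    rw [hφq, hπw, hqw]; simp
  let W : Fin m → R := fun i => w (Pi.single i 1)
  let ρ0 : R → Matrix (Fin m) (Fin m) K⟦X⟧ := fun r i j => φ (W i * r) j
  have hwW : ∀ c, w c = ∑ i, c i • W i := by
    intro c
    conv_lhs => rw [← Finset.univ_sum_single c]
    rw [map_sum]
    refine Finset.sum_congr rfl fun i _ => ?_
    rw [← map_smul]
    congr 1
    ext j
    simp [Pi.single_apply]
  have hmul : ∀ x r j, φ (x * r) j = Matrix.vecMul (φ x) (ρ0 r) j := by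
    intro x r j
    have hstep : ∀ x, φ (x * r) j - Matrix.vecMul (φ x) (ρ0 r) j =
        PowerSeries.X * (φ (q x * r) j - Matrix.vecMul (φ (q x)) (ρ0 r) j) := by
      intro x
      have e1 : φ (x * r) j = (∑ i, PowerSeries.C (π x i) * φ (W i * r) j)
          + PowerSeries.X * φ (q x * r) j := by
        conv_lhs => rw [hq x]
        rw [add_mul, map_add, mul_assoc, Pi.add_apply, hφu, hwW, Finset.sum_mul, map_sum,
          Finset.sum_apply]
        congr 1
        refine Finset.sum_congr rfl fun i _ => ?_
        rw [smul_mul_assoc, map_smul, Pi.smul_apply, PowerSeries.smul_eq_C_mul]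
      have e2 : Matrix.vecMul (φ x) (ρ0 r) j = (∑ i, PowerSeries.C (π x i) * φ (W i * r) j)
          + PowerSeries.X * Matrix.vecMul (φ (q x)) (ρ0 r) j := by
        simp only [Matrix.vecMul, dotProduct]
        rw [Finset.mul_sum, ← Finset.sum_add_distrib]
        refine Finset.sum_congr rfl fun i _ => ?_
        rw [hφq x i]
        change _ * φ (W i * r) j = _ + _ * (_ * φ (W i * r) j)
        ring
      rw [e1, e2]; ring
    have hdvd : ∀ k : ℕ, ∀ x, PowerSeries.X ^ k ∣ φ (x * r) j - Matrix.vecMul (φ x) (ρ0 r) j := by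
      intro k
      induction k with
      | zero => intro x; simp
      | succ k ih =>
        intro x
        rw [hstep, pow_succ']
        exact mul_dvd_mul_left _ (ih _)
    rw [← sub_eq_zero]
    ext k
    have := (PowerSeries.X_pow_dvd_iff.1 (hdvd (k + 1) x)) k (Nat.lt_succ_self k)
    simpa using this
  let ρ : R →ₐ[K] Matrix (Fin m) (Fin m) K⟦X⟧ := AlgHom.ofLinearMap
    { toFun := ρ0
      map_add' := by
        intro x y; ext1 i j
        simp [ρ0, mul_add]
        rfl
      map_smul' := by
        intro c x; ext1 i j
        simp [ρ0]
        rfl }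
    (by
      ext1 i j
      change φ (W i * 1) j = _
      rw [mul_one, hφw, Matrix.one_apply, Pi.single_apply]
      simp only [eq_comm (a := i) (b := j)]
      split_ifs <;> simp)
    (by
      intro x y
      ext1 i j
      change φ (W i * (x * y)) j = (ρ0 x * ρ0 y) i j
      rw [← mul_assoc, hmul, Matrix.mul_apply]
      rfl)
  refine ⟨m, φ, ρ, ?_, ?_, ?_, ?_⟩
  · intro r
    ext1 j
    have := hmul 1 r j
    rw [one_mul] at this
    exact this
  · exact fun r => ⟨q r, fun j => ⟨π r j, hφq r j⟩⟩
  · exact fun r i => ⟨W i * r, fun j => rfl⟩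
  · intro r hr k
    have hz : ∀ k, π ((q ^ k) r) = 0 := by
      intro k
      ext j
      rw [← hφc, hr]; simp
    refine ⟨(q ^ k) r, ?_⟩
    induction k with
    | zero => simp
    | succ k ih =>
      have h3 := hq ((q ^ k) r)
      rw [hz, map_zero, zero_add] at h3
      rw [pow_succ, mul_assoc, pow_succ']
      change r = u ^ k * (u * q ((q ^ k) r))
      rw [← h3]; exact ih

open scoped PowerSeries in
lemma rep_growth {K R : Type*} [Field K] [Ring R] [Algebra K R] (V : Submodule K R) (hV : V.FG)
    (hgen : Algebra.adjoin K (V : Set R) = ⊤)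
    {m : ℕ} (φ : R →ₗ[K] (Fin m → K⟦X⟧)) (ρ : R →ₐ[K] Matrix (Fin m) (Fin m) K⟦X⟧)
    (hφρ : ∀ r, φ r = Matrix.vecMul (φ 1) (ρ r))
    (h1 : ∀ r, ∃ s, ∀ j, ∃ c : K, φ r j = PowerSeries.C c + PowerSeries.X * φ s j)
    (h2 : ∀ r i, ∃ x, ∀ j, ρ r i j = φ x j) (hinj : Function.Injective ρ) :
    ∃ C : ℕ, ∀ n : ℕ, Module.finrank K ↥(V ^ n) ≤ C * (n + 1) := by
  classical
  obtain ⟨S, hS⟩ := hV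
  have hS' : Algebra.adjoin K (S : Set R) = ⊤ := by
    rw [← Algebra.adjoin_span, hS]; exact hgen
  let E := FractionRing K⟦X⟧
  let F := FractionRing K[X]
  have hinjE : Function.Injective (algebraMap K⟦X⟧ E) := IsFractionRing.injective _ _
  let g : K[X] →+* E := (algebraMap K⟦X⟧ E).comp (Polynomial.coeToPowerSeries.ringHom)
  have hg : Function.Injective g := hinjE.comp (Polynomial.coe_injective K)
  letI : Algebra F E := (IsFractionRing.lift (A := K[X]) (K := F) hg).toAlgebra
  have hFE : ∀ p : K[X], algebraMap F E (algebraMap K[X] F p) = algebraMap K⟦X⟧ E (p : K⟦X⟧) :=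
    fun p => IsFractionRing.lift_algebraMap hg p
  have : IsScalarTower K F E := by
    refine IsScalarTower.of_algebraMap_eq fun c => ?_
    rw [IsScalarTower.algebraMap_apply K K[X] F, hFE, IsScalarTower.algebraMap_apply K K⟦X⟧ E]
    congr 1
    exact (Polynomial.coe_C c).symm
  obtain ⟨L, hL, hρL⟩ := field_finite (K := K) (E := E) (F := F) hinjE
    (by rw [hFE, Polynomial.coe_X]) S hS' φ ρ hφρ h1 h2
  let ρ' : R →ₐ[K] Matrix (Fin m) (Fin m) L :=
    { toFun := fun r => Matrix.of fun i j => ⟨algebraMap K⟦X⟧ E (ρ r i j), hρL r i j⟩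
      map_one' := by
        ext i j
        change algebraMap K⟦X⟧ E (ρ 1 i j) = _
        rw [map_one, Matrix.one_apply, Matrix.one_apply]
        split_ifs <;> simp
      map_mul' := by
        intro x y
        ext i j
        rw [Matrix.mul_apply, AddSubmonoidClass.coe_finsetSum]
        change algebraMap K⟦X⟧ E (ρ (x * y) i j) = ∑ k, algebraMap K⟦X⟧ E (ρ x i k) * algebraMap K⟦X⟧ E (ρ y k j)
        rw [map_mul, Matrix.mul_apply, map_sum]
        simp
      map_zero' := by
        ext i j
        change algebraMap K⟦X⟧ E (ρ 0 i j) = 0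
        simp
      map_add' := by
        intro x y
        ext i j
        change algebraMap K⟦X⟧ E (ρ (x + y) i j) = algebraMap K⟦X⟧ E (ρ x i j) + algebraMap K⟦X⟧ E (ρ y i j)
        simp
      commutes' := by
        intro c
        ext i j
        change algebraMap K⟦X⟧ E (ρ (algebraMap K R c) i j) = _
        rw [AlgHom.commutes, Matrix.algebraMap_matrix_apply, Matrix.algebraMap_matrix_apply]
        split_ifs
        · rw [← IsScalarTower.algebraMap_apply]; rfl
        · simp }
  have hρ' : Function.Injective ρ' := by
    intro x y h
    apply hinj
    ext1 i j
    apply hinjE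
    have := congrFun (congrFun h i) j
    exact congrArg Subtype.val this
  obtain ⟨C, hC⟩ := growth_matL (K := K) (F := F) (V.map ρ'.toLinearMap) (Submodule.FG.map _ ⟨S, hS⟩)
  refine ⟨C, fun n => ?_⟩
  rw [← finrank_map_inj ρ'.toLinearMap hρ', Submodule.map_pow]
  exact hC n

lemma isUnit_of_finite {K R : Type*} [Field K] [Ring R] [Algebra K R]
    (hprime : ∀ a b : R, (∀ r : R, a * r * b = 0) → a = 0 ∨ b = 0)
    (hnl : IsNoetherian R R) (hnr : IsNoetherian Rᵐᵒᵖ R)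
    (V : Submodule K R) (hV : V.FG)
    (hgen : Algebra.adjoin K (V : Set R) = ⊤)
    (hgrow : ¬ ∃ C : ℕ, ∀ n : ℕ, Module.finrank K ↥(V ^ n) ≤ C * (n + 1))
    (u : R) (hu : ∀ x y : R, u * x = u * y → x = y)
    (hfin : Module.Finite K (R ⧸ LinearMap.range (LinearMap.mulLeft K u))) : IsUnit u := by
  classical
  obtain ⟨m, φ, ρ, hφρ, h1, h2, h3⟩ := exists_rep u hu hfin
  have hninj : ¬ Function.Injective ρ := fun h => hgrow (rep_growth V hV hgen φ ρ hφρ h1 h2 h)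
  have hker : ∃ b, b ≠ 0 ∧ ρ b = 0 := by
    by_contra hcon
    push Not at hcon
    exact hninj ((injective_iff_map_eq_zero ρ).2 fun a ha => by
      by_contra h; exact hcon a h ha)
  obtain ⟨b0, hb0, hρb0⟩ := hker
  have hpowinj : ∀ k : ℕ, ∀ x y, u ^ k * x = u ^ k * y → x = y := by
    intro k
    induction k with
    | zero => simp
    | succ k ih =>
      intro x y h
      rw [pow_succ, mul_assoc, mul_assoc] at h
      exact hu _ _ (ih _ _ h)
  -- right ideals
  let Bk : ℕ →o Submodule Rᵐᵒᵖ R :=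
    { toFun := fun k =>
        { carrier := {x | ρ (u ^ k * x) = 0}
          add_mem' := by intro x y hx hy; simp only [Set.mem_ofPred_eq] at *; rw [mul_add, map_add, hx, hy, add_zero]
          zero_mem' := by simp
          smul_mem' := by
            intro c x hx
            simp only [Set.mem_ofPred_eq] at *
            rw [MulOpposite.smul_eq_mul_unop, ← mul_assoc, map_mul, hx, zero_mul] }
      monotone' := by
        refine monotone_nat_of_le_succ fun k x hx => ?_
        change ρ (u ^ (k + 1) * x) = 0
        have hx' : ρ (u ^ k * x) = 0 := hx
        rw [pow_succ', mul_assoc, map_mul, hx', mul_zero] }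
  obtain ⟨k, hk⟩ := monotone_stabilizes_iff_noetherian.2 hnr Bk
  have huB : ∀ b, ρ b = 0 → ∃ y, ρ y = 0 ∧ u * y = b := by
    intro b hb
    obtain ⟨z, hz⟩ := h3 b (by rw [hφρ, hb, Matrix.vecMul_zero]) (k + 1)
    have hzk : z ∈ Bk (k + 1) := by
      change ρ (u ^ (k + 1) * z) = 0
      rw [← hz]; exact hb
    rw [← hk (k + 1) (Nat.le_succ k)] at hzk
    exact ⟨u ^ k * z, hzk, by rw [← mul_assoc, ← pow_succ', ← hz]⟩
  -- the kernel as right module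
  let B : Submodule Rᵐᵒᵖ R :=
    { carrier := {x | ρ x = 0}
      add_mem' := by intro x y hx hy; simp only [Set.mem_ofPred_eq] at *; rw [map_add, hx, hy, add_zero]
      zero_mem' := by simp
      smul_mem' := by
        intro c x hx
        simp only [Set.mem_ofPred_eq] at *
        rw [MulOpposite.smul_eq_mul_unop, map_mul, hx, zero_mul] }
  choose! ψ hψB hψ using huB
  obtain ⟨S, hS⟩ := hnr.noetherian B
  have hSB : ∀ s ∈ S, ρ s = 0 := by
    intro s hs
    have : s ∈ B := by rw [← hS]; exact Submodule.subset_span hs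
    exact this
  have hψmul : ∀ b r, ρ b = 0 → ψ (b * r) = ψ b * r := by
    intro b r hb
    apply hu
    rw [hψ _ (by rw [map_mul, hb, zero_mul]), ← mul_assoc, hψ _ hb]
  have hψadd : ∀ b c, ρ b = 0 → ρ c = 0 → ψ (b + c) = ψ b + ψ c := by
    intro b c hb hc
    apply hu
    rw [hψ _ (by rw [map_add, hb, hc, add_zero]), mul_add, hψ _ hb, hψ _ hc]
  have hitB : ∀ (i : ℕ) b, ρ b = 0 → ρ (ψ^[i] b) = 0 := by
    intro i
    induction i with
    | zero => intro b hb; exact hb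
    | succ i ih => intro b hb; rw [Function.iterate_succ_apply']; exact hψB _ (ih b hb)
  have hitu : ∀ (i : ℕ) b, ρ b = 0 → u ^ i * ψ^[i] b = b := by
    intro i
    induction i with
    | zero => intro b hb; simp
    | succ i ih =>
      intro b hb
      rw [Function.iterate_succ_apply', pow_succ, mul_assoc, hψ _ (hitB i b hb), ih b hb]
  -- left module of values on generators
  let P : ℕ →o Submodule R (S → R) :=
    { toFun := fun n => Submodule.span R ((fun i : ℕ => fun s : S => ψ^[i] (s : R)) '' Set.Iic n)
      monotone' := fun a b h => Submodule.span_mono (Set.image_mono (Set.Iic_subset_Iic.2 h)) }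
  have hnoe : IsNoetherian R (S → R) := inferInstance
  obtain ⟨n, hn⟩ := monotone_stabilizes_iff_noetherian.2 hnoe P
  have hmem : (fun s : S => ψ^[n + 1] (s : R)) ∈ P n := by
    rw [hn (n + 1) (Nat.le_succ n)]
    exact Submodule.subset_span ⟨n + 1, Set.mem_Iic.2 le_rfl, rfl⟩
  have hkey : ∀ f ∈ P n, ∃ r : R, ∀ s : S, f s = r * ψ^[n] (s : R) := by
    intro f hf
    induction hf using Submodule.span_induction with
    | mem x hx =>
      obtain ⟨i, hi, rfl⟩ := hx
      refine ⟨u ^ (n - i), fun s => ?_⟩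
      have hi' : i ≤ n := hi
      have : ψ^[n] (s : R) = ψ^[n - i] (ψ^[i] (s : R)) := by
        rw [← Function.iterate_add_apply, Nat.sub_add_cancel hi']
      rw [this, hitu _ _ (hitB _ _ (hSB _ s.2))]
    | zero => exact ⟨0, fun s => by simp⟩
    | add x y _ _ hx hy =>
      obtain ⟨r, hr⟩ := hx
      obtain ⟨r', hr'⟩ := hy
      exact ⟨r + r', fun s => by rw [Pi.add_apply, hr, hr', add_mul]⟩
    | smul a x _ hx =>
      obtain ⟨r, hr⟩ := hx
      exact ⟨a * r, fun s => by rw [Pi.smul_apply, hr, smul_eq_mul, mul_assoc]⟩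
  obtain ⟨r, hr⟩ := hkey _ hmem
  have hitadd : ∀ (i : ℕ) b c, ρ b = 0 → ρ c = 0 → ψ^[i] (b + c) = ψ^[i] b + ψ^[i] c := by
    intro i b c hb hc
    induction i with
    | zero => rfl
    | succ i ih =>
      simp only [Function.iterate_succ_apply']
      rw [ih, hψadd _ _ (hitB i _ hb) (hitB i _ hc)]
  have hitmul : ∀ (i : ℕ) b c, ρ b = 0 → ψ^[i] (b * c) = ψ^[i] b * c := by
    intro i b c hb
    induction i with
    | zero => rfl
    | succ i ih =>
      simp only [Function.iterate_succ_apply']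
      rw [ih, hψmul _ _ (hitB i _ hb)]
  have hit0 : ∀ i : ℕ, ψ^[i] 0 = 0 := by
    intro i
    have := hitadd i 0 0 (by simp) (by simp)
    rw [add_zero] at this
    exact left_eq_add.1 this
  have hall : ∀ b, ρ b = 0 → ψ^[n + 1] b = r * ψ^[n] b := by
    intro b hb
    have hbB : b ∈ Submodule.span Rᵐᵒᵖ (S : Set R) := by rw [hS]; exact hb
    have : ρ b = 0 ∧ ψ^[n + 1] b = r * ψ^[n] b := by
      clear hb
      induction hbB using Submodule.span_induction with
      | mem x hx => exact ⟨hSB x hx, hr ⟨x, hx⟩⟩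
      | zero => exact ⟨by simp, by rw [hit0, hit0, mul_zero]⟩
      | add x y _ _ hx hy =>
        exact ⟨by rw [map_add, hx.1, hy.1, add_zero], by
          rw [hitadd _ _ _ hx.1 hy.1, hitadd _ _ _ hx.1 hy.1, hx.2, hy.2, mul_add]⟩
      | smul a x _ hx =>
        rw [MulOpposite.smul_eq_mul_unop]
        exact ⟨by rw [map_mul, hx.1, zero_mul], by
          rw [hitmul _ _ _ hx.1, hitmul _ _ _ hx.1, hx.2, mul_assoc]⟩
    exact this.2
  -- r * u acts as identity on the kernel
  have hψu : ∀ b, ρ b = 0 → ψ (u * b) = b := by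
    intro b hb
    exact hu _ _ (hψ _ (by rw [map_mul, hb, mul_zero]))
  have hitu' : ∀ (i : ℕ) b, ρ b = 0 → ψ^[i] (u ^ i * b) = b := by
    intro i
    induction i with
    | zero => intro b _; simp
    | succ i ih =>
      intro b hb
      rw [pow_succ', mul_assoc, Function.iterate_succ_apply, hψu _ (by rw [map_mul, hb, mul_zero]), ih b hb]
  have hrb : ∀ b, ρ b = 0 → ψ b = r * b := by
    intro b hb
    have h4 := hall (u ^ n * b) (by rw [map_mul, hb, mul_zero])
    rw [Function.iterate_succ_apply', hitu' n b hb] at h4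
    exact h4
  have hru : r * u = 1 := by
    have : r * u - 1 = 0 ∨ b0 = 0 := by
      refine hprime _ _ fun x => ?_
      have hx : ρ (x * b0) = 0 := by rw [map_mul, hρb0, mul_zero]
      rw [mul_assoc, sub_mul, one_mul, mul_assoc, ← hrb _ (by rw [map_mul, hx, mul_zero]), hψu _ hx, sub_self]
    exact sub_eq_zero.1 (this.resolve_right hb0)
  have hur : u * r = 1 := by
    have : u * r - 1 = 0 ∨ b0 = 0 := by
      refine hprime _ _ fun x => ?_
      have hx : ρ (x * b0) = 0 := by rw [map_mul, hρb0, mul_zero]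
      rw [mul_assoc, sub_mul, one_mul, mul_assoc, ← hrb _ hx, hψ _ hx, sub_self]
    exact sub_eq_zero.1 (this.resolve_right hb0)
  exact ⟨⟨u, r, hur, hru⟩, rfl⟩


lemma bf_of_bound {H : Type*} [Monoid H]
    (hb : ∀ a : H, ∃ N : ℕ, ∀ l : List H, (∀ x ∈ l, ¬ IsUnit x) → l.prod = a → l.length ≤ N) :
    (∀ a : H, ¬ IsUnit a → ∃ l : List H, (∀ x ∈ l, Irreducible x) ∧ l.prod = a) ∧
    ∀ a : H, {k | ∃ l : List H, (∀ x ∈ l, Irreducible x) ∧ l.prod = a ∧ l.length = k}.Finite := by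
  classical
  constructor
  · intro a ha
    obtain ⟨N, hN⟩ := hb a
    let P : ℕ → Prop := fun k => ∃ l : List H, (∀ x ∈ l, ¬ IsUnit x) ∧ l.prod = a ∧ l.length = k
    have hP1 : P 1 := ⟨[a], by simpa using ha, by simp, rfl⟩
    have h1N : 1 ≤ N := by
      obtain ⟨l, h1, h2, h3⟩ := hP1
      rw [← h3]; exact hN l h1 h2
    have hPm : P (Nat.findGreatest P N) := Nat.findGreatest_spec h1N hP1
    obtain ⟨l, hl, hla, hlen⟩ := hPm
    refine ⟨l, fun x hx => ⟨hl x hx, ?_⟩, hla⟩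
    intro b c hbc
    by_contra hcon
    push Not at hcon
    obtain ⟨s, t, rfl⟩ := List.append_of_mem hx
    have hP : P (Nat.findGreatest P N + 1) := by
      refine ⟨s ++ b :: c :: t, ?_, ?_, ?_⟩
      · intro y hy
        simp only [List.mem_append, List.mem_cons] at hy hl
        rcases hy with hy | rfl | rfl | hy
        · exact hl y (Or.inl hy)
        · exact hcon.1
        · exact hcon.2
        · exact hl y (Or.inr (Or.inr hy))
      · rw [← hla]
        simp [hbc, mul_assoc]
      · rw [← hlen]
        simp; omega
    have hle : Nat.findGreatest P N + 1 ≤ N := by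
      obtain ⟨l, h1, h2, h3⟩ := hP
      rw [← h3]; exact hN l h1 h2
    have := Nat.le_findGreatest hle hP
    omega
  · intro a
    obtain ⟨N, hN⟩ := hb a
    refine (Set.finite_Iic N).subset ?_
    rintro k ⟨l, hl, hla, rfl⟩
    exact hN l (fun x hx => (hl x hx).1) hla

section count
variable {K R : Type*} [Field K] [Ring R] [Algebra K R] (V : Submodule K R)

lemma pow_mono' (h1 : (1 : R) ∈ V) {a b : ℕ} (h : a ≤ b) : V ^ a ≤ V ^ b :=
  pow_le_pow_right' (Submodule.one_le.2 h1) h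

lemma exhaust (h1 : (1 : R) ∈ V) (hgen : Algebra.adjoin K (V : Set R) = ⊤) (x : R) :
    ∃ n : ℕ, x ∈ V ^ n := by
  have hx : x ∈ Algebra.adjoin K (V : Set R) := by rw [hgen]; trivial
  induction hx using Algebra.adjoin_induction with
  | mem x hx => exact ⟨1, by simpa using hx⟩
  | algebraMap r => exact ⟨0, by rw [pow_zero]; exact Submodule.algebraMap_mem r⟩
  | add x y _ _ hx hy =>
    obtain ⟨a, ha⟩ := hx
    obtain ⟨b, hb⟩ := hy
    exact ⟨max a b, add_mem (pow_mono' V h1 (le_max_left a b) ha)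
      (pow_mono' V h1 (le_max_right a b) hb)⟩
  | mul x y _ _ hx hy =>
    obtain ⟨a, ha⟩ := hx
    obtain ⟨b, hb⟩ := hy
    exact ⟨a + b, by rw [pow_add]; exact Submodule.mul_mem_mul ha hb⟩

/-- right ideal as a subspace -/
abbrev RI (K : Type*) {R : Type*} [Field K] [Ring R] [Algebra K R] (c : R) : Submodule K R :=
  LinearMap.range (LinearMap.mulLeft K c)

lemma fd_pow (hV : V.FG) (n : ℕ) : FiniteDimensional K ↥(V ^ n) :=
  Module.Finite.iff_fg.2 (hV.pow n)

lemma count_one (h1 : (1 : R) ∈ V) (hV : V.FG) (hgen : Algebra.adjoin K (V : Set R) = ⊤) (c : R)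
    (hc : ¬ Module.Finite K (R ⧸ RI K c)) (n : ℕ) :
    Module.finrank K ↥(V ^ n ⊓ RI K c) + n ≤ Module.finrank K ↥(V ^ n) := by
  have hfd := fun n => fd_pow V hV n
  let q := (RI K c).mkQ
  have hq : ∀ n, n ≤ Module.finrank K ↥((V ^ n).map q) := by
    intro n
    induction n with
    | zero => exact Nat.zero_le _
    | succ n ih =>
      refine Nat.lt_of_le_of_lt ih ?_
      refine Submodule.finrank_lt_finrank_of_lt (lt_of_le_of_ne
        (Submodule.map_mono (pow_mono' V h1 (Nat.le_succ n))) ?_)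
      intro heq
      apply hc
      have hcl : ∀ x ∈ V ^ n ⊔ RI K c, ∀ v ∈ V, x * v ∈ V ^ n ⊔ RI K c := by
        intro x hx v hv
        obtain ⟨a, ha, b, hb, rfl⟩ := Submodule.mem_sup.1 hx
        rw [add_mul]
        refine add_mem ?_ (Submodule.mem_sup_right ?_)
        · have h2 : a * v ∈ V ^ (n + 1) := by rw [pow_succ]; exact Submodule.mul_mem_mul ha hv
          have h3 : q (a * v) ∈ (V ^ n).map q := by
            rw [heq]; exact Submodule.mem_map_of_mem h2
          have h4 : a * v ∈ ((V ^ n).map q).comap q := h3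
          rw [Submodule.comap_map_mkQ] at h4
          rwa [sup_comm]
        · obtain ⟨y, rfl⟩ := hb
          exact ⟨y * v, by simp [mul_assoc]⟩
      have hall : ∀ k : ℕ, V ^ k ≤ V ^ n ⊔ RI K c := by
        intro k
        induction k with
        | zero =>
          refine le_trans ?_ le_sup_left
          exact pow_mono' V h1 (Nat.zero_le n)
        | succ k ih =>
          rw [pow_succ, Submodule.mul_le]
          exact fun x hx v hv => hcl x (ih hx) v hv
      have htop : (V ^ n).map q = ⊤ := by
        rw [eq_top_iff]
        rintro y -
        obtain ⟨x, rfl⟩ := (RI K c).mkQ_surjective y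
        obtain ⟨k, hk⟩ := exhaust V h1 hgen x
        have h5 := hall k hk
        rw [sup_comm, ← Submodule.comap_map_mkQ] at h5
        exact h5
      rw [Module.finite_def, ← htop]
      exact (hV.pow n).map q
  have hrn := LinearMap.finrank_range_add_finrank_ker (q.domRestrict (V ^ n))
  rw [LinearMap.range_domRestrict, LinearMap.ker_domRestrict] at hrn
  have hk : Module.finrank K ↥((LinearMap.ker q).submoduleOf (V ^ n)) =
      Module.finrank K ↥(V ^ n ⊓ RI K c) := by
    rw [← finrank_map_inj (V ^ n).subtype (Submodule.subtype_injective _)]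
    rw [Submodule.submoduleOf, Submodule.map_comap_subtype, Submodule.ker_mkQ]
  have := hq n
  have hrn' : Module.finrank K ↥((V ^ n).map q) + Module.finrank K ↥(V ^ n ⊓ RI K c) =
      Module.finrank K ↥(V ^ n) := by
    rw [← hk]; exact hrn
  omega

lemma count_step (hV : V.FG) (x p : R) (hx : ∀ a b : R, x * a = x * b → a = b)
    (D0 l : ℕ) (hxD : x ∈ V ^ D0) :
    Module.finrank K ↥(V ^ (D0 + l) ⊓ RI K (x * p)) + Module.finrank K ↥(V ^ l) ≤
    Module.finrank K ↥(V ^ (D0 + l) ⊓ RI K x) + Module.finrank K ↥(V ^ l ⊓ RI K p) := by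
  have hfd := fun n => fd_pow V hV n
  have hinj : Function.Injective (LinearMap.mulLeft K x) := fun a b h => hx a b h
  have e := Submodule.finrank_sup_add_finrank_inf_eq (V ^ (D0 + l) ⊓ RI K (x * p))
    ((V ^ l).map (LinearMap.mulLeft K x))
  rw [finrank_map_inj _ hinj] at e
  have hle : (V ^ (D0 + l) ⊓ RI K (x * p)) ⊔ ((V ^ l).map (LinearMap.mulLeft K x)) ≤
      V ^ (D0 + l) ⊓ RI K x := by
    refine sup_le (inf_le_inf_left _ ?_) (le_inf ?_ ?_)
    · rintro _ ⟨y, rfl⟩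
      exact ⟨p * y, by simp [mul_assoc]⟩
    · rintro _ ⟨y, hy, rfl⟩
      rw [pow_add]
      exact Submodule.mul_mem_mul hxD hy
    · rintro _ ⟨y, hy, rfl⟩
      exact ⟨y, rfl⟩
  have hle2 : (V ^ (D0 + l) ⊓ RI K (x * p)) ⊓ ((V ^ l).map (LinearMap.mulLeft K x)) ≤
      (V ^ l ⊓ RI K p).map (LinearMap.mulLeft K x) := by
    rintro _ ⟨⟨_, ⟨z, hz⟩⟩, ⟨y, hy, rfl⟩⟩
    refine ⟨y, ⟨hy, ⟨z, ?_⟩⟩, rfl⟩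
    apply hx
    simp only [LinearMap.mulLeft_apply, mul_assoc] at hz ⊢
    exact hz
  have i1 := Submodule.finrank_mono hle
  have i2 := Submodule.finrank_mono hle2
  rw [finrank_map_inj _ hinj] at i2
  omega

lemma count_list (h1 : (1 : R) ∈ V) (hV : V.FG) (hgen : Algebra.adjoin K (V : Set R) = ⊤)
    (l : List R) (hl : ∀ c ∈ l, (∀ a b : R, c * a = c * b → a = b) ∧
      ¬ Module.Finite K (R ⧸ RI K c)) :
    ∃ D : ℕ, ∀ n : ℕ, Module.finrank K ↥(V ^ (D + n) ⊓ RI K l.prod) + l.length * n ≤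
      Module.finrank K ↥(V ^ (D + n)) := by
  have hfd := fun n => fd_pow V hV n
  induction l with
  | nil =>
    refine ⟨0, fun n => ?_⟩
    simp only [List.length_nil, zero_mul, add_zero]
    exact Submodule.finrank_mono inf_le_left
  | cons c t ih =>
    obtain ⟨D, hD⟩ := ih fun y hy => hl y (List.mem_cons_of_mem _ hy)
    obtain ⟨hc, hc'⟩ := hl c List.mem_cons_self
    obtain ⟨D0, hD0⟩ := exhaust V h1 hgen c
    refine ⟨D0 + D, fun n => ?_⟩
    have e1 := count_step V hV c t.prod hc D0 (D + n) hD0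
    have e2 := count_one V h1 hV hgen c hc' (D0 + (D + n))
    have e3 := hD n
    rw [List.prod_cons, List.length_cons, add_assoc, add_mul, one_mul]
    omega

lemma lower (hV : V.FG) (a : R) (ha : ∀ x y : R, a * x = a * y → x = y) (d l : ℕ)
    (had : a ∈ V ^ d) :
    Module.finrank K ↥(V ^ l) ≤ Module.finrank K ↥(V ^ (d + l) ⊓ RI K a) := by
  have hfd := fun n => fd_pow V hV n
  have hinj : Function.Injective (LinearMap.mulLeft K a) := fun x y h => ha x y h
  rw [← finrank_map_inj _ hinj]
  refine Submodule.finrank_mono (le_inf ?_ ?_)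
  · rintro _ ⟨y, hy, rfl⟩
    rw [pow_add]
    exact Submodule.mul_mem_mul had hy
  · rintro _ ⟨y, hy, rfl⟩
    exact ⟨y, rfl⟩

end count

/-- If `f` is quadratically bounded, increments over step `d` are often at most linear. -/
lemma incr (f : ℕ → ℝ) (hf : ∀ n, 0 ≤ f n) (c : ℝ) (hc : 0 < c) (d : ℕ) (hd : 1 ≤ d)
    (h : ∀ n : ℕ, 1 ≤ n → f n ≤ c * (n : ℝ) ^ 2) (D k : ℕ)
    (hk : ∀ n : ℕ, D + d ≤ n → (k : ℝ) * ((n : ℝ) - D) ≤ f n - f (n - d)) :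
    (k : ℝ) ≤ 8 * c * d + 1 := by
  have hj : ∀ j : ℕ, (k : ℝ) * d * (j : ℝ) ^ 2 / 2 ≤ f (D + j * d) := by
    intro j
    induction j with
    | zero => simpa using hf D
    | succ j ih =>
      have e := hk (D + (j + 1) * d) (by nlinarith)
      rw [show D + (j + 1) * d - d = D + j * d by rw [add_mul, one_mul]; omega] at e
      push_cast at e ⊢
      have hkd : (0 : ℝ) ≤ k * d := by positivity
      nlinarith
  have e1 := hj (D + 1)
  have e2 := h (D + (D + 1) * d) (by nlinarith)
  have hd' : (1 : ℝ) ≤ d := by exact_mod_cast hd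
  push_cast at e1 e2
  set J : ℝ := (D : ℝ) + 1 with hJ
  have hJ1 : (1 : ℝ) ≤ J := by rw [hJ]; linarith [Nat.cast_nonneg (α := ℝ) D]
  have hD0 : (0 : ℝ) ≤ D := Nat.cast_nonneg D
  have e3 : (D : ℝ) + J * d ≤ 2 * (J * d) := by nlinarith
  have e4 : ((D : ℝ) + J * d) ^ 2 ≤ (2 * (J * d)) ^ 2 := by
    apply pow_le_pow_left₀ _ e3
    positivity
  have e5 : (k : ℝ) * d * J ^ 2 / 2 ≤ c * (2 * (J * d)) ^ 2 :=
    e1.trans (e2.trans (mul_le_mul_of_nonneg_left e4 hc.le))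
  have hpos : 0 < (d : ℝ) * J ^ 2 := by positivity
  have e6 : (k : ℝ) * (d * J ^ 2) ≤ (8 * c * d) * (d * J ^ 2) := by nlinarith
  have := le_of_mul_le_mul_right e6 hpos
  linarith

theorem bound {K R : Type*} [Field K] [Ring R] [Algebra K R] (V : Submodule K R)
    (h1 : (1 : R) ∈ V) (hV : V.FG) (hgen : Algebra.adjoin K (V : Set R) = ⊤) (c₂ : ℝ)
    (hc₂ : 0 < c₂)
    (hg : ∀ n : ℕ, 1 ≤ n → (Module.finrank K ↥(V ^ n) : ℝ) ≤ c₂ * (n : ℝ) ^ 2)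
    (a : R) (ha : ∀ x y : R, a * x = a * y → x = y) :
    ∃ N : ℕ, ∀ l : List R, (∀ c ∈ l, (∀ a b : R, c * a = c * b → a = b) ∧
      ¬ Module.Finite K (R ⧸ RI K c)) → l.prod = a → l.length ≤ N := by
  obtain ⟨d0, hd0⟩ := exhaust V h1 hgen a
  have hd1 : a ∈ V ^ (d0 + 1) := pow_mono' V h1 (Nat.le_succ d0) hd0
  refine ⟨⌊8 * c₂ * (d0 + 1 : ℕ) + 1⌋₊, fun l hl hla => ?_⟩
  obtain ⟨D, hD⟩ := count_list V h1 hV hgen l hl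
  refine Nat.le_floor ?_
  refine incr (fun n => (Module.finrank K ↥(V ^ n) : ℝ)) (fun n => Nat.cast_nonneg _) c₂ hc₂ (d0 + 1)
    (Nat.le_add_left 1 d0) hg D l.length ?_
  intro n hn
  have e1 := lower V hV a ha (d0 + 1) (n - (d0 + 1)) hd1
  have e2 := hD (n - D)
  rw [hla] at e2
  rw [show d0 + 1 + (n - (d0 + 1)) = n by omega] at e1
  rw [show D + (n - D) = n by omega] at e2
  have e3 : Module.finrank K ↥(V ^ (n - (d0 + 1))) + l.length * (n - D) ≤
    Module.finrank K ↥(V ^ n) := by omega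
  have e4 : ((Module.finrank K ↥(V ^ (n - (d0 + 1))) : ℝ)) + l.length * ((n : ℝ) - D) ≤
      Module.finrank K ↥(V ^ n) := by
    rw [← Nat.cast_sub (show D ≤ n by omega)]
    exact_mod_cast e3
  linarith

end BFQ

/-- Let `K` be a field and `R` an affine (finitely generated)
left and right noetherian prime `K`-algebra of quadratic growth: there is a frame
`V` (a finite-dimensional subspace containing `1` and generating `R` as a
`K`-algebra) and constants `c₁, c₂ > 0` with `c₁ n² ≤ dim V^n ≤ c₂ n²` for all
`n ≥ 1`.  Then `R` is a BF-ring. -/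
theorem isBFRing_of_quadraticGrowth {K R : Type*} [Field K] [Ring R] [Algebra K R]
    (haff : Algebra.FiniteType K R) (hprime : IsPrimeRing R)
    (hnl : IsNoetherian R R) (hnr : IsNoetherian Rᵐᵒᵖ R)
    (hquad : ∃ (V : Submodule K R) (c₁ c₂ : ℝ),
      (1 : R) ∈ V ∧ FiniteDimensional K V ∧ Algebra.adjoin K (V : Set R) = ⊤ ∧
      0 < c₁ ∧ 0 < c₂ ∧
      ∀ n : ℕ, 1 ≤ n →
        c₁ * (n : ℝ) ^ 2 ≤ (Module.finrank K ↥(V ^ n) : ℝ) ∧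
        (Module.finrank K ↥(V ^ n) : ℝ) ≤ c₂ * (n : ℝ) ^ 2) :
    IsBFRing R := by
  obtain ⟨V, c₁, c₂, h1, hfd, hgen, hc₁, hc₂, hg⟩ := hquad
  have hV : V.FG := Module.Finite.iff_fg.1 hfd
  have hgrow : ¬ ∃ C : ℕ, ∀ n : ℕ, Module.finrank K ↥(V ^ n) ≤ C * (n + 1) := by
    rintro ⟨C, hC⟩
    obtain ⟨n, hn⟩ := exists_nat_gt (2 * (C : ℝ) / c₁)
    have hn0 : (0 : ℝ) < n := lt_of_le_of_lt (by positivity) hn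
    have hn1 : 1 ≤ n := by exact_mod_cast hn0
    have hn1' : (1 : ℝ) ≤ n := by exact_mod_cast hn1
    have e1 := (hg n hn1).1
    have e2 : (Module.finrank K ↥(V ^ n) : ℝ) ≤ C * (n + 1) := by exact_mod_cast hC n
    rw [div_lt_iff₀ hc₁] at hn
    have hC0 : (0 : ℝ) ≤ C := Nat.cast_nonneg C
    nlinarith
  refine BFQ.bf_of_bound fun a => ?_
  obtain ⟨N, hN⟩ := BFQ.bound V h1 hV hgen c₂ hc₂ (fun n hn => (hg n hn).2) (a : R) a.2.1
  refine ⟨N, fun l hl hla => ?_⟩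
  have := hN (l.map (cancellativeSubmonoid R).subtype) ?_ ?_
  · simpa using this
  · intro c hc
    obtain ⟨x, hx, rfl⟩ := List.mem_map.1 hc
    refine ⟨x.2.1, fun hfin => hl x hx ?_⟩
    obtain ⟨⟨u, v, huv, hvu⟩, hu⟩ := BFQ.isUnit_of_finite hprime hnl hnr V hV hgen hgrow (x : R) x.2.1 hfin
    have hu' : u = (x : R) := hu
    have hv : v ∈ cancellativeSubmonoid R := by
      refine ⟨fun y z h => ?_, fun y z h => ?_⟩
      · rw [← one_mul y, ← huv, mul_assoc, h, ← mul_assoc, huv, one_mul]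
      · rw [← mul_one y, ← hvu, ← mul_assoc, h, mul_assoc, hvu, mul_one]
    exact ⟨⟨x, ⟨v, hv⟩, Subtype.ext (by simpa [hu'] using huv),
      Subtype.ext (by simpa [hu'] using hvu)⟩, rfl⟩
  · rw [← map_list_prod, hla]; rfl
end
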